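/- Let Λ = (α_1, α_2, β_2, β_3, β_4) be five distinct real numbers with α_2 + β_2 ≠ β_3 + β_4, let n ≥ 1, and let a_i ∈ ℝ and b_i > 0 define tridiagonal matrices C_1, …, C_n by the recursion. The following are equivalent: (i) spec(C_1) = {α_1} and spec(C_i) ∩ Λ = {α_i, β_i} for i = 2, …, n (with the periodic index extension); (ii) a_i = α_1 for odd i ≤ n, a_2 = −α_1 + α_2 + β_2, a_i = α_2 for even i with 2 < i ≤ n, b_2 = (β_2 − α_1)(α_1 − α_2), b_3 = (β_3 − α_2)(β_3 − β_2), b_4 = (β_4 − α_1)(β_3 − β_4)(α_2 + β_2 − β_3 − β_4)/(β_4 − β_2), and b_i = (β_i − α_1)(β_i − α_2) for 4 < i ≤ n. Moreover, when these equivalent conditions hold and n ≥ 4, then Λ ∈ B. -/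

import Mathlib

/-- The recursively defined tridiagonal matrices `C_n`: `C_n` is tridiagonal with
diagonal `(a_n, …, a_1)`, superdiagonal `(b_n, …, b_2)` and all subdiagonal entries `1`;
equivalently `C_1 = (a_1)` and `C_{k+1}` has `(1,1)` entry `a_{k+1}`, `(1,2)` entry
`b_{k+1}`, `(2,1)` entry `1`, and trailing principal `k×k` submatrix `C_k`. -/
def triC (a b : ℕ → ℝ) (n : ℕ) : Matrix (Fin n) (Fin n) ℝ :=
  Matrix.of fun j k =>
    if j.val = k.val then a (n - j.val)
    else if j.val + 1 = k.val then b (n - j.val)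
    else if k.val + 1 = j.val then 1
    else 0

/-- The periodic extension `α_i`: `α_i = α_1` for odd `i` and `α_i = α_2` for even `i`. -/
noncomputable def alphaP (α1 α2 : ℝ) (i : ℕ) : ℝ :=
  if i % 2 = 1 then α1 else α2

/-- The periodic extension `β_i`: `β_i = β_k` for the unique `k ∈ {2,3,4}` with
`i ≡ k (mod 3)`. -/
noncomputable def betaP (β2 β3 β4 : ℝ) (i : ℕ) : ℝ :=
  if i % 3 = 2 then β2 else if i % 3 = 0 then β3 else β4

/-- The diagonal entries `a_i` determined by `Λ = (α_1, α_2, β_2, β_3, β_4)`. -/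
noncomputable def aLam (α1 α2 β2 : ℝ) : ℕ → ℝ := fun i =>
  if i = 2 then -α1 + α2 + β2 else if i % 2 = 1 then α1 else α2

/-- The superdiagonal entries `b_i` determined by `Λ = (α_1, α_2, β_2, β_3, β_4)`. -/
noncomputable def bLam (α1 α2 β2 β3 β4 : ℝ) : ℕ → ℝ := fun i =>
  if i = 2 then (β2 - α1) * (α1 - α2)
  else if i = 3 then (β3 - α2) * (β3 - β2)
  else if i = 4 then (β4 - α1) * (β3 - β4) * (α2 + β2 - β3 - β4) / (β4 - β2)
  else (betaP β2 β3 β4 i - α1) * (betaP β2 β3 β4 i - α2)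

/-- Membership of `Λ = (α_1, α_2, β_2, β_3, β_4)` in the set `𝓑`: the five values are
distinct and the quantities `b_2, b_3, b_4` and `(β_j - α_1)(β_j - α_2)`, `j = 2,3,4`,
are all strictly positive. -/
def memB (α1 α2 β2 β3 β4 : ℝ) : Prop :=
  List.Pairwise (· ≠ ·) [α1, α2, β2, β3, β4] ∧
  0 < (β2 - α1) * (α1 - α2) ∧
  0 < (β3 - α2) * (β3 - β2) ∧
  0 < (β4 - α1) * (β3 - β4) * (α2 + β2 - β3 - β4) / (β4 - β2) ∧
  0 < (β2 - α1) * (β2 - α2) ∧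
  0 < (β3 - α1) * (β3 - α2) ∧
  0 < (β4 - α1) * (β4 - α2)

/-- Values of the characteristic polynomials, via the three-term recursion. -/
noncomputable def ppv (a b : ℕ → ℝ) (x : ℝ) : ℕ → ℝ
  | 0 => 1
  | 1 => x - a 1
  | (n+2) => (x - a (n+2)) * ppv a b x (n+1) - b (n+2) * ppv a b x n

theorem det_step (a b : ℕ → ℝ) (x : ℝ) (n : ℕ) :
    (Matrix.scalar (Fin (n+2)) x - triC a b (n+2)).det =
      (x - a (n+2)) * (Matrix.scalar (Fin (n+1)) x - triC a b (n+1)).det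
        - b (n+2) * (Matrix.scalar (Fin n) x - triC a b n).det := by
  have h1 : (Matrix.scalar (Fin (n+2)) x - triC a b (n+2)).submatrix Fin.succ
      (Fin.succAbove 0) = Matrix.scalar (Fin (n+1)) x - triC a b (n+1) := by
    ext i j
    simp [triC, Matrix.diagonal_apply]
  have h2 : ((Matrix.scalar (Fin (n+2)) x - triC a b (n+2)).submatrix Fin.succ
      (Fin.succAbove 1)).submatrix (Fin.succAbove 0) Fin.succ
        = Matrix.scalar (Fin n) x - triC a b n := by
    ext i j
    simp [triC, Matrix.diagonal_apply, Fin.succAbove, Fin.lt_def]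
  have h3 : ((Matrix.scalar (Fin (n+2)) x - triC a b (n+2)).submatrix Fin.succ
      (Fin.succAbove 1)).det = - (Matrix.scalar (Fin n) x - triC a b n).det := by
    rw [Matrix.det_succ_column_zero, Fin.sum_univ_succ, h2, Finset.sum_eq_zero]
    · simp [triC, Matrix.diagonal_apply, Fin.succAbove, Fin.lt_def]
    · intro i _
      simp [triC, Matrix.diagonal_apply, Fin.succAbove, Fin.lt_def, Fin.ext_iff]
  rw [Matrix.det_succ_row_zero, Fin.sum_univ_succ, Fin.sum_univ_succ, h1]
  rw [Finset.sum_eq_zero (s := Finset.univ) (f := fun i : Fin n => _)]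
  · rw [show (Fin.succ 0 : Fin (n+2)) = 1 from rfl, h3]
    simp [triC, Matrix.diagonal_apply]
    ring
  · intro i _
    simp [triC, Matrix.diagonal_apply, Fin.ext_iff]

theorem ppv_eval_det (a b : ℕ → ℝ) (x : ℝ) : ∀ n : ℕ,
    (Matrix.scalar (Fin n) x - triC a b n).det = ppv a b x n
  | 0 => by simp [ppv]
  | 1 => by simp [ppv, triC]
  | (n+2) => by rw [det_step, ppv_eval_det a b x (n+1), ppv_eval_det a b x n, ppv]

theorem root_iff (a b : ℕ → ℝ) (x : ℝ) (n : ℕ) :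
    (triC a b n).charpoly.IsRoot x ↔ ppv a b x n = 0 := by
  rw [Polynomial.IsRoot.def, Matrix.eval_charpoly, ppv_eval_det]

theorem ppv_rec (a b : ℕ → ℝ) (x : ℝ) (n : ℕ) : ppv a b x (n+2) =
    (x - a (n+2)) * ppv a b x (n+1) - b (n+2) * ppv a b x n := by rw [ppv]

theorem ppv_nocommon (a b : ℕ → ℝ) (x : ℝ) (n : ℕ)
    (hb : ∀ i, 2 ≤ i → i ≤ n → 0 < b i) :
    ∀ i, i + 1 ≤ n → ppv a b x i = 0 → ppv a b x (i+1) ≠ 0 := by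
  intro i
  induction i with
  | zero => intro _ h; simp [ppv] at h
  | succ i ih =>
    intro hi h0 h1
    rw [ppv_rec, h0] at h1
    have := hb (i+2) (by omega) (by omega)
    have h2 : ppv a b x i = 0 := by
      have : b (i+2) * ppv a b x i = 0 := by linarith
      rcases mul_eq_zero.mp this with h | h
      · linarith
      · exact h
    exact ih (by omega) h2 h0

theorem alphaP_add (α1 α2 : ℝ) (i : ℕ) : alphaP α1 α2 (i+2) = alphaP α1 α2 i := by
  unfold alphaP; rw [Nat.add_mod_right]

theorem betaP_add (β2 β3 β4 : ℝ) (i : ℕ) : betaP β2 β3 β4 (i+3) = betaP β2 β3 β4 i := by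
  unfold betaP; rw [Nat.add_mod_right]

theorem alphaP_mem (α1 α2 β2 β3 β4 : ℝ) (i : ℕ) :
    alphaP α1 α2 i ∈ ({α1, α2, β2, β3, β4} : Set ℝ) := by
  unfold alphaP; split_ifs <;> simp

theorem betaP_mem (α1 α2 β2 β3 β4 : ℝ) (i : ℕ) :
    betaP β2 β3 β4 i ∈ ({α1, α2, β2, β3, β4} : Set ℝ) := by
  unfold betaP; split_ifs <;> simp

theorem mem_cases (α1 α2 β2 β3 β4 x : ℝ) (i : ℕ)
    (hx : x ∈ ({α1, α2, β2, β3, β4} : Set ℝ)) :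
    x = alphaP α1 α2 i ∨ x = alphaP α1 α2 (i+1) ∨ x = betaP β2 β3 β4 i ∨
      x = betaP β2 β3 β4 (i+1) ∨ x = betaP β2 β3 β4 (i+2) := by
  have h2 : i % 2 = 0 ∧ (i+1) % 2 = 1 ∨ i % 2 = 1 ∧ (i+1) % 2 = 0 := by omega
  have h3 : i % 3 = 0 ∧ (i+1) % 3 = 1 ∧ (i+2) % 3 = 2 ∨ i % 3 = 1 ∧ (i+1) % 3 = 2 ∧ (i+2) % 3 = 0
    ∨ i % 3 = 2 ∧ (i+1) % 3 = 0 ∧ (i+2) % 3 = 1 := by omega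
  simp only [Set.mem_insert_iff, Set.mem_singleton_iff] at hx
  unfold alphaP betaP
  rcases h2 with ⟨e1, e2⟩ | ⟨e1, e2⟩ <;> rcases h3 with ⟨e3, e4, e5⟩ | ⟨e3, e4, e5⟩ | ⟨e3, e4, e5⟩ <;>
    simp only [e1, e2, e3, e4, e5] <;> simp <;> tauto

theorem alpha_ne_succ (α1 α2 : ℝ) (h : α1 ≠ α2) (i : ℕ) :
    alphaP α1 α2 i ≠ alphaP α1 α2 (i+1) := by
  have h2 : i % 2 = 0 ∧ (i+1) % 2 = 1 ∨ i % 2 = 1 ∧ (i+1) % 2 = 0 := by omega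
  unfold alphaP
  rcases h2 with ⟨e1, e2⟩ | ⟨e1, e2⟩ <;> simp [e1, e2, h, h.symm]

theorem beta_ne_succ (β2 β3 β4 : ℝ) (h1 : β2 ≠ β3) (h2 : β2 ≠ β4) (h3 : β3 ≠ β4) (i j : ℕ)
    (hij : i % 3 ≠ j % 3) :
    betaP β2 β3 β4 i ≠ betaP β2 β3 β4 j := by
  unfold betaP
  split_ifs <;> first | omega | assumption | (apply Ne.symm; assumption)

theorem alpha_ne_beta (α1 α2 β2 β3 β4 : ℝ)
    (hdist : List.Pairwise (· ≠ ·) [α1, α2, β2, β3, β4]) (i j : ℕ) :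
    betaP β2 β3 β4 j ≠ alphaP α1 α2 i := by
  simp at hdist
  obtain ⟨⟨h1,h2,h3,h4⟩,⟨h5,h6,h7⟩,⟨h8,h9⟩,h10⟩ := hdist
  unfold betaP alphaP
  split_ifs <;> apply Ne.symm <;> assumption

theorem forward (α1 α2 β2 β3 β4 : ℝ)
    (hdist : List.Pairwise (· ≠ ·) [α1, α2, β2, β3, β4])
    (n : ℕ) (hn : 1 ≤ n)
    (a b : ℕ → ℝ) (hb : ∀ i, 2 ≤ i → i ≤ n → 0 < b i)
    (H1 : ppv a b α1 1 = 0)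
    (H : ∀ i, 2 ≤ i → i ≤ n → ∀ x ∈ ({α1, α2, β2, β3, β4} : Set ℝ),
          (ppv a b x i = 0 ↔ (x = alphaP α1 α2 i ∨ x = betaP β2 β3 β4 i))) :
      ((∀ i, 1 ≤ i → i ≤ n → a i = aLam α1 α2 β2 i) ∧
       (∀ i, 2 ≤ i → i ≤ n → b i = bLam α1 α2 β2 β3 β4 i)) := by
  have hab := alpha_ne_beta α1 α2 β2 β3 β4 hdist
  have hd := hdist
  simp at hd
  obtain ⟨⟨h1,h2,h3,h4⟩,⟨h5,h6,h7⟩,⟨h8,h9⟩,h10⟩ := hd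
  have Ha : ∀ i, 1 ≤ i → i ≤ n → ppv a b (alphaP α1 α2 i) i = 0 := by
    intro i hi hin
    rcases Nat.lt_or_ge i 2 with h | h
    · obtain rfl : i = 1 := by omega
      simpa [alphaP] using H1
    · exact (H i h hin _ (alphaP_mem ..)).2 (Or.inl rfl)
  have Hb : ∀ i, 2 ≤ i → i ≤ n → ppv a b (betaP β2 β3 β4 i) i = 0 := by
    intro i hi hin
    exact (H i hi hin _ (betaP_mem ..)).2 (Or.inr rfl)
  have a1 : a 1 = α1 := by simp only [ppv] at H1; linarith
  have A2 : 2 ≤ n → a 2 = -α1 + α2 + β2 ∧ b 2 = (β2 - α1) * (α1 - α2) := by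
    intro h
    have e1 := Ha 2 (by omega) h
    have e2 := Hb 2 (by omega) h
    simp [ppv, alphaP, betaP, a1] at e1 e2
    have e3 : (α2 - β2) * (a 2 - (-α1 + α2 + β2)) = 0 := by linear_combination e2 - e1
    have e4 : a 2 = -α1 + α2 + β2 := by
      rcases mul_eq_zero.mp e3 with h | h
      · exact absurd (sub_eq_zero.mp h) h5
      · linarith
    refine ⟨e4, ?_⟩
    rw [e4] at e1
    linear_combination -e1
  have A3 : ∀ i, i + 3 ≤ n → a (i+3) = alphaP α1 α2 (i+3) := by
    intro i hi
    have e1 := Ha (i+3) (by omega) hi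
    have e2 := Ha (i+1) (by omega) (by omega)
    rw [← alphaP_add] at e2
    have e3 : ppv a b (alphaP α1 α2 (i+3)) (i+2) ≠ 0 := by
      rw [Ne, H (i+2) (by omega) (by omega) _ (alphaP_mem ..)]
      rintro (h | h)
      · exact alpha_ne_succ α1 α2 h1 (i+2) h.symm
      · exact hab _ _ h.symm
    rw [ppv_rec] at e1
    rw [show i + 1 + 2 = i + 3 from rfl] at e1 e2
    rw [e2, mul_zero, sub_zero] at e1
    rcases mul_eq_zero.mp e1 with h | h
    · linarith
    · exact absurd h e3
  have B3 : 3 ≤ n → b 3 = (β3 - α2) * (β3 - β2) := by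
    intro h
    obtain ⟨q1, q2⟩ := A2 (by omega)
    have q3 := A3 0 h
    have e := Hb 3 (by omega) h
    simp [ppv, alphaP, betaP, a1, q1, q2] at e q3
    rw [q3] at e
    have : (β3 - α1) * (b 3 - (β3 - α2) * (β3 - β2)) = 0 := by linear_combination -e
    rcases mul_eq_zero.mp this with h | h
    · exact absurd (sub_eq_zero.mp h).symm h3
    · linarith
  have B4 : 4 ≤ n → b 4 = (β4 - α1) * (β3 - β4) * (α2 + β2 - β3 - β4) / (β4 - β2) := by
    intro h
    obtain ⟨q1, q2⟩ := A2 (by omega)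
    have q3 := A3 0 (by omega)
    have q4 := A3 1 h
    have q5 := B3 (by omega)
    have e := Hb 4 (by omega) h
    simp [ppv, alphaP, betaP, a1, q1, q2, q5] at e q3 q4
    rw [q3, q4] at e
    have hne : β4 - β2 ≠ 0 := sub_ne_zero.mpr (Ne.symm h9)
    rw [eq_div_iff hne]
    have : (β4 - α2) * (b 4 * (β4 - β2) - (β4 - α1) * (β3 - β4) * (α2 + β2 - β3 - β4)) = 0 := by
      linear_combination -e
    rcases mul_eq_zero.mp this with h | h
    · exact absurd (sub_eq_zero.mp h).symm h7
    · linarith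
  have B5 : ∀ i, i + 5 ≤ n → b (i+5) = (betaP β2 β3 β4 (i+5) - α1) * (betaP β2 β3 β4 (i+5) - α2) := by
    intro i hi
    have e := Hb (i+5) (by omega) hi
    have e2 := Hb (i+2) (by omega) (by omega)
    rw [← betaP_add] at e2
    rw [show i + 2 + 3 = i + 5 from rfl] at e2
    have e3 : ppv a b (betaP β2 β3 β4 (i+5)) (i+3) ≠ 0 := by
      rw [Ne, H (i+3) (by omega) (by omega) _ (betaP_mem ..)]
      rintro (h | h)
      · exact hab _ _ h
      · exact beta_ne_succ β2 β3 β4 h8 h9 h10 _ _ (by omega) h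
    have r1 := ppv_rec a b (betaP β2 β3 β4 (i+5)) (i+3)
    have r2 := ppv_rec a b (betaP β2 β3 β4 (i+5)) (i+2)
    simp only [show i + 3 + 2 = i + 5 from rfl, show i + 3 + 1 = i + 4 from rfl,
      show i + 2 + 2 = i + 4 from rfl, show i + 2 + 1 = i + 3 from rfl] at r1 r2
    rw [e, r2, e2, A3 (i+2) hi, A3 (i+1) (by omega)] at r1
    simp only [show i + 2 + 3 = i + 5 from rfl, show i + 1 + 3 = i + 4 from rfl] at r1
    have hal : (betaP β2 β3 β4 (i+5) - alphaP α1 α2 (i+5)) * (betaP β2 β3 β4 (i+5) - alphaP α1 α2 (i+4)) = (betaP β2 β3 β4 (i+5) - α1) * (betaP β2 β3 β4 (i+5) - α2) := by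
      have : (i+5) % 2 = 1 ∧ (i+4) % 2 = 0 ∨ (i+5) % 2 = 0 ∧ (i+4) % 2 = 1 := by omega
      unfold alphaP
      rcases this with ⟨u, v⟩ | ⟨u, v⟩ <;> simp [u, v]
      ring
    apply mul_right_cancel₀ e3
    rw [← hal]
    linear_combination r1
  constructor
  · intro i hi hin
    unfold aLam
    rcases Nat.lt_or_ge i 3 with h | h
    · interval_cases i
      · simpa using a1
      · simpa using (A2 hin).1
    · obtain ⟨k, rfl⟩ := Nat.exists_eq_add_of_le' h
      rw [A3 k hin, if_neg (by omega)]; rfl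
  · intro i hi hin
    unfold bLam
    rcases Nat.lt_or_ge i 5 with h | h
    · interval_cases i
      · simpa using (A2 hin).2
      · simpa using B3 hin
      · simpa using B4 hin
    · obtain ⟨k, rfl⟩ := Nat.exists_eq_add_of_le' h
      rw [B5 k hin, if_neg (by omega), if_neg (by omega), if_neg (by omega)]

theorem backward (α1 α2 β2 β3 β4 : ℝ)
    (hdist : List.Pairwise (· ≠ ·) [α1, α2, β2, β3, β4])
    (hsum : α2 + β2 ≠ β3 + β4)
    (n : ℕ) (hn : 1 ≤ n)
    (a b : ℕ → ℝ) (hb : ∀ i, 2 ≤ i → i ≤ n → 0 < b i)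
    (HA : ∀ i, 1 ≤ i → i ≤ n → a i = aLam α1 α2 β2 i)
    (HB : ∀ i, 2 ≤ i → i ≤ n → b i = bLam α1 α2 β2 β3 β4 i) :
    ∀ i, 2 ≤ i → i ≤ n → ∀ x ∈ ({α1, α2, β2, β3, β4} : Set ℝ),
          (ppv a b x i = 0 ↔ (x = alphaP α1 α2 i ∨ x = betaP β2 β3 β4 i)) := by
  have hab := alpha_ne_beta α1 α2 β2 β3 β4 hdist
  have hd := hdist
  simp at hd
  obtain ⟨⟨h1,h2,h3,h4⟩,⟨h5,h6,h7⟩,⟨h8,h9⟩,h10⟩ := hd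
  have a1 : a 1 = α1 := by rw [HA 1 le_rfl hn]; simp [aLam]
  have a2 : 2 ≤ n → a 2 = -α1 + α2 + β2 := fun h => by rw [HA 2 (by omega) h]; simp [aLam]
  have b2 : 2 ≤ n → b 2 = (β2 - α1) * (α1 - α2) := fun h => by
    rw [HB 2 (by omega) h]; simp [bLam]
  have b3 : 3 ≤ n → b 3 = (β3 - α2) * (β3 - β2) := fun h => by
    rw [HB 3 (by omega) h]; simp [bLam]
  have b4 : 4 ≤ n → b 4 = (β4 - α1) * (β3 - β4) * (α2 + β2 - β3 - β4) / (β4 - β2) := fun h => by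
    rw [HB 4 (by omega) h]; simp [bLam]
  have A3 : ∀ i, i + 3 ≤ n → a (i+3) = alphaP α1 α2 (i+3) := by
    intro i hi
    rw [HA (i+3) (by omega) hi]; unfold aLam; rw [if_neg (by omega)]; rfl
  have B5 : ∀ i, i + 5 ≤ n → b (i+5) = (betaP β2 β3 β4 (i+5) - α1) * (betaP β2 β3 β4 (i+5) - α2) := by
    intro i hi
    rw [HB (i+5) (by omega) hi]; unfold bLam
    rw [if_neg (by omega), if_neg (by omega), if_neg (by omega)]
  have P2 : 2 ≤ n → ∀ x, ppv a b x 2 = (x - α2) * (x - β2) := by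
    intro h x
    simp only [ppv, a1, a2 h, b2 h, zero_add]
    ring
  have P3 : 3 ≤ n → ∀ x, ppv a b x 3 = (x - α1) * (x - β3) * (x + β3 - α2 - β2) := by
    intro h x
    have := A3 0 h
    simp [alphaP] at this
    rw [ppv_rec a b x 1, P2 (by omega)]
    simp only [ppv, a1, b3 h, this]
    ring
  have Ha : ∀ i, i + 1 ≤ n → ppv a b (alphaP α1 α2 (i+1)) (i+1) = 0 := by
    intro i
    induction i using Nat.twoStepInduction with
    | zero => intro _; simp [ppv, alphaP, a1]
    | one => intro h; rw [P2 h]; simp [alphaP]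
    | more i ih _ =>
      intro h
      have e := ih (by omega)
      rw [← alphaP_add] at e
      rw [ppv_rec, A3 i h]
      simp only [show i + 1 + 2 = i + 3 from rfl] at e ⊢
      rw [show i + 2 + 1 = i + 3 from rfl, e]
      ring
  have Hb : ∀ i, i + 2 ≤ n → ppv a b (betaP β2 β3 β4 (i+2)) (i+2) = 0 := by
    intro i
    induction i using Nat.strong_induction_on with
    | _ i ih =>
    intro h
    rcases Nat.lt_or_ge i 3 with h' | h'
    · interval_cases i
      · rw [P2 h]; simp [betaP]
      · rw [P3 h]; simp [betaP]
      · have := A3 1 h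
        simp [alphaP] at this
        rw [ppv_rec, P2 (by omega), P3 (by omega), this, b4 h]
        simp only [betaP]
        have hne : β4 - β2 ≠ 0 := sub_ne_zero.mpr (Ne.symm h9)
        simp
        field_simp
        ring
    · obtain ⟨k, rfl⟩ := Nat.exists_eq_add_of_le' h'
      have e2 := ih k (by omega) (by omega)
      rw [← betaP_add] at e2
      simp only [show k + 3 + 2 = k + 5 from rfl, show k + 2 + 3 = k + 5 from rfl] at e2 ⊢
      have r1 := ppv_rec a b (betaP β2 β3 β4 (k+5)) (k+3)
      have r2 := ppv_rec a b (betaP β2 β3 β4 (k+5)) (k+2)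
      simp only [show k + 3 + 2 = k + 5 from rfl, show k + 3 + 1 = k + 4 from rfl,
        show k + 2 + 2 = k + 4 from rfl, show k + 2 + 1 = k + 3 from rfl] at r1 r2
      rw [r1, r2, e2, A3 (k+2) h, A3 (k+1) (by omega), B5 k h]
      simp only [show k + 2 + 3 = k + 5 from rfl, show k + 1 + 3 = k + 4 from rfl]
      have : (k+5) % 2 = 1 ∧ (k+4) % 2 = 0 ∨ (k+5) % 2 = 0 ∧ (k+4) % 2 = 1 := by omega
      unfold alphaP
      rcases this with ⟨u, v⟩ | ⟨u, v⟩ <;> simp [u, v] <;> ring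
  have Nc := fun x => ppv_nocommon a b x n hb
  intro i hi hin x hx
  obtain ⟨k, rfl⟩ := Nat.exists_eq_add_of_le' hi
  constructor
  · intro h0
    rcases mem_cases α1 α2 β2 β3 β4 x (k+2) hx with h | h | h | h | h
    · exact Or.inl h
    · exfalso
      have e := Ha k (by omega)
      rw [← alphaP_add, show k + 1 + 2 = k + 2 + 1 from rfl, ← h] at e
      exact Nc x (k+1) hin e h0
    · exact Or.inr h
    · exfalso
      rcases Nat.lt_or_ge k 2 with h' | h'
      · interval_cases k
        · simp [betaP] at h
          subst h
          rw [P2 hin] at h0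
          rcases mul_eq_zero.mp h0 with h | h
          · exact h6 (sub_eq_zero.mp h).symm
          · exact h8 (sub_eq_zero.mp h).symm
        · simp [betaP] at h
          subst h
          rw [P3 hin] at h0
          rcases mul_eq_zero.mp h0 with h | h
          · rcases mul_eq_zero.mp h with h | h
            · exact h4 (sub_eq_zero.mp h).symm
            · exact h10 (sub_eq_zero.mp h).symm
          · apply hsum; linarith
      · obtain ⟨m, rfl⟩ := Nat.exists_eq_add_of_le' h'
        have e := Hb m (by omega)
        rw [← betaP_add, show m + 2 + 3 = m + 2 + 2 + 1 from rfl, ← h] at e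
        rw [ppv_rec, e, A3 (m+1) hin, mul_zero, sub_zero] at h0
        rcases mul_eq_zero.mp h0 with h' | h'
        · rw [h] at h'
          exact hab _ _ (sub_eq_zero.mp h')
        · exact Nc x (m+2) (by omega) e h'
    · exfalso
      rcases Nat.eq_zero_or_pos k with rfl | h'
      · simp [betaP] at h
        subst h
        rw [P2 hin] at h0
        rcases mul_eq_zero.mp h0 with h | h
        · exact h7 (sub_eq_zero.mp h).symm
        · exact h9 (sub_eq_zero.mp h).symm
      · obtain ⟨m, rfl⟩ := Nat.exists_eq_add_of_le' h'
        have e := Hb m (by omega)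
        rw [← betaP_add, show m + 2 + 3 = m + 1 + 2 + 2 from rfl, ← h] at e
        exact Nc x (m+2) hin e h0
  · rintro (rfl | rfl)
    · exact Ha (k+1) hin
    · exact Hb k hin

theorem memB_aux (α1 α2 β2 β3 β4 : ℝ) (h : α2 < α1) (h' : α1 < β2)
    (p3 : 0 < (β3 - α2) * (β3 - β2))
    (p4 : 0 < (β4 - α1) * (β3 - β4) * (α2 + β2 - β3 - β4) / (β4 - β2)) :
    0 < (β3 - α1) * (β3 - α2) ∧ 0 < (β4 - α1) * (β4 - α2) := by
  have hc : 0 < ((β4 - α1) * (β4 - β2)) * ((β4 - β3) * (β4 - (α2 + β2 - β3))) := by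
    have hne : β4 - β2 ≠ 0 := by
      intro h0; rw [h0, div_zero] at p4; exact lt_irrefl _ p4
    have := mul_pos p4 (pow_pos (abs_pos.mpr hne) 2)
    rw [sq_abs] at this
    have e : (β4 - α1) * (β3 - β4) * (α2 + β2 - β3 - β4) / (β4 - β2) * (β4 - β2)^2 =
      ((β4 - α1) * (β4 - β2)) * ((β4 - β3) * (β4 - (α2 + β2 - β3))) := by
      field_simp
      ring
    rwa [e] at this
  have hout : β3 < α2 ∨ β2 < β3 := by
    by_contra! hh
    nlinarith [mul_nonneg (sub_nonneg.mpr hh.1) (sub_nonneg.mpr hh.2)]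
  constructor
  · rcases hout with g | g
    · exact mul_pos_of_neg_of_neg (by linarith) (by linarith)
    · exact mul_pos (by linarith) (by linarith)
  · by_contra hcon
    have hin : α2 ≤ β4 ∧ β4 ≤ α1 := by
      constructor
      · by_contra! g
        exact hcon (mul_pos_of_neg_of_neg (by linarith) (by linarith))
      · by_contra! g
        exact hcon (mul_pos (by linarith) (by linarith))
    have q1 : 0 ≤ (β4 - α1) * (β4 - β2) :=
      mul_nonneg_of_nonpos_of_nonpos (by linarith) (by linarith)
    have q2 : (β4 - β3) * (β4 - (α2 + β2 - β3)) ≤ 0 := by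
      rcases hout with g | g
      · exact mul_nonpos_of_nonneg_of_nonpos (by linarith) (by linarith)
      · exact mul_nonpos_of_nonpos_of_nonneg (by linarith) (by linarith)
    have := mul_nonpos_of_nonneg_of_nonpos q1 q2
    linarith

theorem memB_of_pos (α1 α2 β2 β3 β4 : ℝ)
    (hdist : List.Pairwise (· ≠ ·) [α1, α2, β2, β3, β4])
    (p2 : 0 < (β2 - α1) * (α1 - α2))
    (p3 : 0 < (β3 - α2) * (β3 - β2))
    (p4 : 0 < (β4 - α1) * (β3 - β4) * (α2 + β2 - β3 - β4) / (β4 - β2)) :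
    memB α1 α2 β2 β3 β4 := by
  refine ⟨hdist, p2, p3, p4, ?_⟩
  rcases pos_and_pos_or_neg_and_neg_of_mul_pos p2 with ⟨u, v⟩ | ⟨u, v⟩
  · exact ⟨mul_pos u (by linarith),
      memB_aux α1 α2 β2 β3 β4 (by linarith) (by linarith) p3 p4⟩
  · refine ⟨mul_pos_of_neg_of_neg u (by linarith), ?_⟩
    have := memB_aux (-α1) (-α2) (-β2) (-β3) (-β4) (by linarith) (by linarith)
      (by linarith [p3]) (by
        convert p4 using 1
        rw [show -β4 - -β2 = -(β4 - β2) by ring, div_neg, ← neg_div]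
        congr 1; ring)
    obtain ⟨w1, w2⟩ := this
    constructor <;> linarith

/-- (Proposition 4.4) Let `Λ = (α_1, α_2, β_2, β_3, β_4)` be five distinct
reals with `α_2 + β_2 ≠ β_3 + β_4`, let `n ≥ 1`, and let `a_i ∈ ℝ`, `b_i > 0` define the
tridiagonal matrices `C_1, …, C_n`.  Then condition (i) (`spec(C_1) = {α_1}` and
`spec(C_i) ∩ Λ = {α_i, β_i}` for `2 ≤ i ≤ n`) is equivalent to condition (ii) (the explicit
formulas for the `a_i` and `b_i`); moreover if these hold and `n ≥ 4` then `Λ ∈ 𝓑`. -/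
theorem triC_spec_iff_formulas (α1 α2 β2 β3 β4 : ℝ)
    (hdist : List.Pairwise (· ≠ ·) [α1, α2, β2, β3, β4])
    (hsum : α2 + β2 ≠ β3 + β4)
    (n : ℕ) (hn : 1 ≤ n)
    (a b : ℕ → ℝ) (hb : ∀ i, 2 ≤ i → i ≤ n → 0 < b i) :
    (((∀ x : ℝ, (triC a b 1).charpoly.IsRoot x ↔ x = α1) ∧
        (∀ i, 2 ≤ i → i ≤ n → ∀ x ∈ ({α1, α2, β2, β3, β4} : Set ℝ),
          ((triC a b i).charpoly.IsRoot x ↔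
            (x = alphaP α1 α2 i ∨ x = betaP β2 β3 β4 i))))
      ↔
      ((∀ i, 1 ≤ i → i ≤ n → a i = aLam α1 α2 β2 i) ∧
       (∀ i, 2 ≤ i → i ≤ n → b i = bLam α1 α2 β2 β3 β4 i)))
    ∧
    ((4 ≤ n ∧ (∀ i, 1 ≤ i → i ≤ n → a i = aLam α1 α2 β2 i) ∧
        (∀ i, 2 ≤ i → i ≤ n → b i = bLam α1 α2 β2 β3 β4 i)) →
      memB α1 α2 β2 β3 β4) := by
  constructor
  · simp only [root_iff]
    constructor
    · rintro ⟨H1, H⟩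
      exact forward α1 α2 β2 β3 β4 hdist n hn a b hb ((H1 α1).2 rfl) H
    · rintro ⟨HA, HB⟩
      refine ⟨?_, backward α1 α2 β2 β3 β4 hdist hsum n hn a b hb HA HB⟩
      intro x
      have a1 : a 1 = α1 := by rw [HA 1 le_rfl hn]; simp [aLam]
      simp only [ppv, a1]
      exact sub_eq_zero
  · rintro ⟨h4, HA, HB⟩
    have p2 := hb 2 le_rfl (by omega)
    have p3 := hb 3 (by omega) (by omega)
    have p4 := hb 4 (by omega) h4
    rw [HB 2 le_rfl (by omega)] at p2
    rw [HB 3 (by omega) (by omega)] at p3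
    rw [HB 4 (by omega) h4] at p4
    simp [bLam] at p2 p3 p4
    exact memB_of_pos α1 α2 β2 β3 β4 hdist p2 p3 p4
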